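/- Let R be a Poisson subalgebra of P containing H₁. If some element of R has a nonzero degree-k harmonic component, then H_k ⊆ R. -/

import Mathlib

open MvPolynomial MeasureTheory

noncomputable section

attribute [local instance] Classical.propDecidable

/-- The Poisson bracket on `ℝ[X₀,X₁,X₂]` associated to the sphere:
`{f,g} = Σ εᵢⱼₖ Xᵢ ∂f/∂Xⱼ ∂g/∂Xₖ` (indices `0,1,2` play the role of `1,2,3`). -/
def pb (f g : MvPolynomial (Fin 3) ℝ) : MvPolynomial (Fin 3) ℝ :=
  X 0 * (pderiv 1 f * pderiv 2 g - pderiv 2 f * pderiv 1 g) +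
  X 1 * (pderiv 2 f * pderiv 0 g - pderiv 0 f * pderiv 2 g) +
  X 2 * (pderiv 0 f * pderiv 1 g - pderiv 1 f * pderiv 0 g)

/-- The ideal generated by `X₀² + X₁² + X₂² - s²`. -/
def sphereIdeal (s : ℝ) : Ideal (MvPolynomial (Fin 3) ℝ) :=
  Ideal.span {X 0 ^ 2 + X 1 ^ 2 + X 2 ^ 2 - C (s ^ 2)}

/-- The Poisson algebra `P` of polynomial functions on the sphere of radius `s`. -/
abbrev SpherePoly (s : ℝ) := MvPolynomial (Fin 3) ℝ ⧸ sphereIdeal s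

/-- The quotient map `ℝ[X₀,X₁,X₂] → P`. -/
def toSphere (s : ℝ) : MvPolynomial (Fin 3) ℝ →+* SpherePoly s :=
  Ideal.Quotient.mk (sphereIdeal s)

/-- The components `S₁, S₂, S₃` of the spin vector (indexed by `Fin 3`). -/
def S (s : ℝ) (i : Fin 3) : SpherePoly s := toSphere s (X i)

/-- A choice of polynomial representative of an element of `P`. -/
def rep (s : ℝ) (p : SpherePoly s) : MvPolynomial (Fin 3) ℝ :=
  (Ideal.Quotient.mk_surjective (I := sphereIdeal s) p).choose

/-- The Poisson bracket descended to `P`.  (It is independent of the choice of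
representatives, since the bracket of any polynomial with the generator
`X₀² + X₁² + X₂² - s²` vanishes identically.) -/
def pbS (s : ℝ) (p q : SpherePoly s) : SpherePoly s :=
  toSphere s (pb (rep s p) (rep s q))

/-- The Laplacian on `ℝ[X₀,X₁,X₂]` as a linear map. -/
def laplacian : MvPolynomial (Fin 3) ℝ →ₗ[ℝ] MvPolynomial (Fin 3) ℝ :=
  (pderiv 0).toLinearMap ∘ₗ (pderiv 0).toLinearMap +
  (pderiv 1).toLinearMap ∘ₗ (pderiv 1).toLinearMap +
  (pderiv 2).toLinearMap ∘ₗ (pderiv 2).toLinearMap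

/-- Homogeneous harmonic polynomials of degree `l`. -/
def harmonicHomog (l : ℕ) : Submodule ℝ (MvPolynomial (Fin 3) ℝ) :=
  homogeneousSubmodule (Fin 3) ℝ l ⊓ LinearMap.ker laplacian

/-- `H_l`, the image in `P` of the homogeneous harmonic polynomials of degree `l`. -/
def Hsph (s : ℝ) (l : ℕ) : Submodule ℝ (SpherePoly s) :=
  (harmonicHomog l).map (Ideal.Quotient.mkₐ ℝ (sphereIdeal s)).toLinearMap

/-- `O`, the odd polynomials: the sum of the `H_l` over odd `l`. -/
def Osph (s : ℝ) : Submodule ℝ (SpherePoly s) :=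
  ⨆ (l : ℕ) (_ : Odd l), Hsph s l

/-- `Õ = ℝ·1 ⊕ O`. -/
def Otilde (s : ℝ) : Submodule ℝ (SpherePoly s) :=
  Submodule.span ℝ ({1} : Set (SpherePoly s)) ⊔ Osph s

theorem S_mem_H1 (s : ℝ) (i : Fin 3) : S s i ∈ Hsph s 1 := by
  refine ⟨X i, ⟨isHomogeneous_X _ _, ?_⟩, rfl⟩
  fin_cases i <;> simp [laplacian, pderiv_X]

theorem S_mem_Otilde (s : ℝ) (i : Fin 3) : S s i ∈ Otilde s :=
  Submodule.mem_sup_right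
    ((le_iSup₂ (f := fun (l : ℕ) (_ : Odd l) => Hsph s l) 1 odd_one) (S_mem_H1 s i))

theorem one_mem_Otilde (s : ℝ) : (1 : SpherePoly s) ∈ Otilde s :=
  Submodule.mem_sup_left (Submodule.mem_span_singleton_self 1)

/-- The degree-`k` harmonic component of `p ∈ P`: the (unique) element `q ∈ H_k` such that
`p - q` lies in the sum of the `H_l` over `l ≠ k`.  (Existence and uniqueness hold since `P`
is the internal direct sum of the `H_l`.) -/
def hcomp (s : ℝ) (k : ℕ) (p : SpherePoly s) : SpherePoly s :=
  if h : ∃ q, q ∈ Hsph s k ∧ p - q ∈ ⨆ (l : ℕ) (_ : l ≠ k), Hsph s l then h.choose else 0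

/-- The partial derivatives of a polynomial commute. -/
theorem pderiv_comm {σ K : Type*} [CommRing K] (i j : σ) (f : MvPolynomial σ K) :
    pderiv i (pderiv j f) = pderiv j (pderiv i f) := by
  have h : ⁅(pderiv i : Derivation K (MvPolynomial σ K) (MvPolynomial σ K)),
      (pderiv j : Derivation K (MvPolynomial σ K) (MvPolynomial σ K))⁆ = 0 := by
    refine derivation_ext fun l => ?_
    classical
    simp [Derivation.commutator_apply, pderiv_X, Pi.single_apply, apply_ite]
  simpa [Derivation.commutator_apply, sub_eq_zero] using congrArg (fun D => D f) h

/-- The infinitesimal rotation `{X i, ·}` about the `i`-th axis. -/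
def rot (i : Fin 3) : Derivation ℝ (MvPolynomial (Fin 3) ℝ) (MvPolynomial (Fin 3) ℝ) :=
  (X (i + 2) : MvPolynomial (Fin 3) ℝ) • pderiv (i + 1) -
    (X (i + 1) : MvPolynomial (Fin 3) ℝ) • pderiv (i + 2)

theorem rot_zero_apply (f : MvPolynomial (Fin 3) ℝ) :
    rot 0 f = X 2 * pderiv 1 f - X 1 * pderiv 2 f := rfl

theorem rot_one_apply (f : MvPolynomial (Fin 3) ℝ) :
    rot 1 f = X 0 * pderiv 2 f - X 2 * pderiv 0 f := rfl

theorem rot_two_apply (f : MvPolynomial (Fin 3) ℝ) :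
    rot 2 f = X 1 * pderiv 0 f - X 0 * pderiv 1 f := rfl

theorem pb_X_left (i : Fin 3) (f : MvPolynomial (Fin 3) ℝ) : pb (X i) f = rot i f := by
  fin_cases i <;>
    simp [pb, rot_zero_apply, rot_one_apply, rot_two_apply, pderiv_X, sub_eq_add_neg, add_comm]

theorem rot_zero_rot_one_sub (f : MvPolynomial (Fin 3) ℝ) :
    rot 0 (rot 1 f) - rot 1 (rot 0 f) = rot 2 f := by
  have h : ⁅rot 0, rot 1⁆ = rot 2 := by
    refine derivation_ext fun l => ?_
    fin_cases l <;>
      simp [Derivation.commutator_apply, rot_zero_apply, rot_one_apply, rot_two_apply, pderiv_X]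
  exact congrArg (fun D => D f) h

theorem laplacian_apply (f : MvPolynomial (Fin 3) ℝ) :
    laplacian f = pderiv 0 (pderiv 0 f) + pderiv 1 (pderiv 1 f) + pderiv 2 (pderiv 2 f) := rfl

theorem laplacian_rot (i : Fin 3) (f : MvPolynomial (Fin 3) ℝ) :
    laplacian (rot i f) = rot i (laplacian f) := by
  have h10 := pderiv_comm (K := ℝ) (1 : Fin 3) 0
  have h20 := pderiv_comm (K := ℝ) (2 : Fin 3) 0
  have h21 := pderiv_comm (K := ℝ) (2 : Fin 3) 1
  fin_cases i <;>
    simp [laplacian_apply, rot_zero_apply, rot_one_apply, rot_two_apply, pderiv_X, h10, h20, h21] <;>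
    ring

theorem rot_mem_harmonicHomog {l : ℕ} (i : Fin 3) {f : MvPolynomial (Fin 3) ℝ}
    (hf : f ∈ harmonicHomog l) : rot i f ∈ harmonicHomog l := by
  obtain ⟨h1, h2⟩ := hf
  refine ⟨?_, by 
    rw [SetLike.mem_coe, LinearMap.mem_ker] at h2 ⊢
    rw [laplacian_rot, h2, map_zero]⟩
  rcases l with _ | l
  · rw [SetLike.mem_coe, mem_homogeneousSubmodule, ← totalDegree_zero_iff_isHomogeneous] at h1
    rw [totalDegree_eq_zero_iff_eq_C.mp h1, derivation_C]
    exact zero_mem _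
  · have key (a b : Fin 3) : (X a * pderiv b f).IsHomogeneous (l + 1) := by
      rw [add_comm]
      exact (isHomogeneous_X _ a).mul (IsHomogeneous.pderiv (i := b) h1)
    exact IsHomogeneous.sub (key (i + 2) (i + 1)) (key (i + 1) (i + 2))

/-- The Casimir operator `-∑ i, {X i, {X i, ·}}`. -/
def casimir : Module.End ℝ (MvPolynomial (Fin 3) ℝ) :=
  -((rot 0).toLinearMap ∘ₗ (rot 0).toLinearMap + (rot 1).toLinearMap ∘ₗ (rot 1).toLinearMap +
    (rot 2).toLinearMap ∘ₗ (rot 2).toLinearMap)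

theorem casimir_apply (f : MvPolynomial (Fin 3) ℝ) :
    casimir f = -(rot 0 (rot 0 f) + rot 1 (rot 1 f) + rot 2 (rot 2 f)) := rfl

theorem casimir_of_mem_harmonicHomog {l : ℕ} {f : MvPolynomial (Fin 3) ℝ}
    (hf : f ∈ harmonicHomog l) : casimir f = ((l : ℝ) * (l + 1)) • f := by
  obtain ⟨h1, h2⟩ := hf
  rw [SetLike.mem_coe, LinearMap.mem_ker, laplacian_apply] at h2
  have h10 := pderiv_comm (K := ℝ) (1 : Fin 3) 0
  have h20 := pderiv_comm (K := ℝ) (2 : Fin 3) 0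
  have h21 := pderiv_comm (K := ℝ) (2 : Fin 3) 1
  have e := IsHomogeneous.sum_X_mul_pderiv h1
  rw [Fin.sum_univ_three, nsmul_eq_mul] at e
  have e0 := congrArg (pderiv 0) e
  have e1 := congrArg (pderiv 1) e
  have e2 := congrArg (pderiv 2) e
  have hc (i : Fin 3) : pderiv i (l : MvPolynomial (Fin 3) ℝ) = 0 := by
    rw [← map_natCast (C : ℝ →+* _), pderiv_C]
  simp [pderiv_X, h10, h20, h21, hc] at e0 e1 e2
  rw [MvPolynomial.smul_eq_C_mul, casimir_apply]
  simp [rot_zero_apply, rot_one_apply, rot_two_apply, pderiv_X, h10, h20, h21]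
  linear_combination (-(X 0 ^ 2 + X 1 ^ 2 + X 2 ^ 2)) * h2 + X 0 * e0 + X 1 * e1 + X 2 * e2 +
    (l + 1) * e

/-! ### The complexification in the coordinates `u = x + iy`, `v = x - iy`, `z` -/

/-- The raising operator in the coordinates `u, v, z`. -/
def raise : Derivation ℂ (MvPolynomial (Fin 3) ℂ) (MvPolynomial (Fin 3) ℂ) :=
  (2 * X 2 : MvPolynomial (Fin 3) ℂ) • pderiv 1 - (X 0 : MvPolynomial (Fin 3) ℂ) • pderiv 2

/-- The lowering operator in the coordinates `u, v, z`. -/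
def lower : Derivation ℂ (MvPolynomial (Fin 3) ℂ) (MvPolynomial (Fin 3) ℂ) :=
  (X 1 : MvPolynomial (Fin 3) ℂ) • pderiv 2 - (2 * X 2 : MvPolynomial (Fin 3) ℂ) • pderiv 0

/-- The weight operator in the coordinates `u, v, z`. -/
def weightOp : Derivation ℂ (MvPolynomial (Fin 3) ℂ) (MvPolynomial (Fin 3) ℂ) :=
  (X 0 : MvPolynomial (Fin 3) ℂ) • pderiv 0 - (X 1 : MvPolynomial (Fin 3) ℂ) • pderiv 1

theorem raise_apply (f : MvPolynomial (Fin 3) ℂ) :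
    raise f = 2 * X 2 * pderiv 1 f - X 0 * pderiv 2 f := rfl

theorem lower_apply (f : MvPolynomial (Fin 3) ℂ) :
    lower f = X 1 * pderiv 2 f - 2 * X 2 * pderiv 0 f := rfl

theorem weightOp_apply (f : MvPolynomial (Fin 3) ℂ) :
    weightOp f = X 0 * pderiv 0 f - X 1 * pderiv 1 f := rfl

theorem pderiv_two (i : Fin 3) : pderiv i (2 : MvPolynomial (Fin 3) ℂ) = 0 := by
  rw [← map_ofNat (C : ℂ →+* _), pderiv_C]

theorem raise_lower (f : MvPolynomial (Fin 3) ℂ) :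
    raise (lower f) = lower (raise f) + 2 * weightOp f := by
  have h : ⁅raise, lower⁆ = (2 : MvPolynomial (Fin 3) ℂ) • weightOp := by
    refine derivation_ext fun l => ?_
    fin_cases l <;>
      simp [Derivation.commutator_apply, raise_apply, lower_apply, weightOp_apply, pderiv_X,
        pderiv_two, mul_comm]
  exact sub_eq_iff_eq_add'.mp (congrArg (fun D => D f) h)

theorem weightOp_lower (f : MvPolynomial (Fin 3) ℂ) :
    weightOp (lower f) = lower (weightOp f) - lower f := by
  have h : ⁅weightOp, lower⁆ = -lower := by
    refine derivation_ext fun l => ?_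
    fin_cases l <;>
      simp [Derivation.commutator_apply, lower_apply, weightOp_apply, pderiv_X, pderiv_two]
  rw [sub_eq_add_neg]
  exact sub_eq_iff_eq_add'.mp (congrArg (fun D => D f) h)

theorem coeff_weightOp (f : MvPolynomial (Fin 3) ℂ) (m : Fin 3 →₀ ℕ) :
    coeff m (weightOp f) = ((m 0 : ℂ) - m 1) * coeff m f := by
  have key (i : Fin 3) : coeff m (X i * pderiv i f) = m i * coeff m f := by
    induction f using MvPolynomial.induction_on' with
    | monomial s r =>
      rw [X_mul_pderiv_monomial, coeff_smul, coeff_monomial, nsmul_eq_mul]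
      split_ifs with h <;> simp [h]
    | add p q hp hq => simp [mul_add, hp, hq]
  rw [weightOp_apply, coeff_sub, key, key, sub_mul]

theorem coeff_raise_pow {n : ℕ} (f : MvPolynomial (Fin 3) ℂ) (m : Fin 3 →₀ ℕ)
    (hm : 2 * m 0 + m 2 < n) : coeff m (raise^[n] f) = 0 := by
  induction n generalizing m with
  | zero => simp at hm
  | succ n ih =>
    rw [Function.iterate_succ_apply', raise_apply, mul_assoc, ← map_ofNat (C : ℂ →+* _), coeff_sub,
      coeff_C_mul, coeff_X_mul', coeff_X_mul', coeff_pderiv, coeff_pderiv]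
    have h2 : (2 : Fin 3) ∈ m.support →
        coeff (m - Finsupp.single 2 1 + Finsupp.single 1 1) (raise^[n] f) = 0 := by
      intro h
      have := Finsupp.mem_support_iff.mp h
      refine ih _ ?_
      simp
      omega
    have h0 : (0 : Fin 3) ∈ m.support →
        coeff (m - Finsupp.single 0 1 + Finsupp.single 2 1) (raise^[n] f) = 0 := by
      intro h
      have := Finsupp.mem_support_iff.mp h
      refine ih _ ?_
      simp
      omega
    split_ifs with h h' h' <;> simp [*]

theorem exponent_sum {k : ℕ} {f : MvPolynomial (Fin 3) ℂ} (hf : f.IsHomogeneous k)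
    {m : Fin 3 →₀ ℕ} (hm : coeff m f ≠ 0) : m 0 + m 1 + m 2 = k := by
  have := hf hm
  rwa [Finsupp.weight_apply, Finsupp.sum_fintype _ _ (by simp), Fin.sum_univ_three,
    Pi.one_apply, Pi.one_apply, Pi.one_apply, smul_eq_mul, smul_eq_mul, smul_eq_mul,
    mul_one, mul_one, mul_one] at this

theorem raise_pow_eq_zero {k : ℕ} {f : MvPolynomial (Fin 3) ℂ}
    (hf : (raise^[2 * k + 1] f).IsHomogeneous k) : raise^[2 * k + 1] f = 0 := by
  ext m
  rw [coeff_zero]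
  by_contra h
  have := exponent_sum hf h
  exact h (coeff_raise_pow f m (by omega))

/-- A homogeneous highest weight vector is a multiple of `u ^ k`. -/
theorem eq_smul_X_pow {k : ℕ} {f : MvPolynomial (Fin 3) ℂ} (hf : f.IsHomogeneous k)
    (hw : weightOp (weightOp f) + weightOp f = ((k : ℂ) * (k + 1)) • f) :
    ∃ c : ℂ, f = c • X 0 ^ k := by
  refine ⟨coeff (Finsupp.single 0 k) f, ?_⟩
  ext m
  rw [coeff_smul, coeff_X_pow, smul_eq_mul, mul_ite, mul_one, mul_zero]
  split_ifs with h
  · rw [h]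
  · by_contra hm
    have hs := exponent_sum hf hm
    have e := congrArg (coeff m) hw
    rw [coeff_add, coeff_weightOp, coeff_weightOp, coeff_smul, smul_eq_mul] at e
    have e' : (((m 0 : ℂ) - m 1 - k) * (m 0 - m 1 + k + 1)) * coeff m f = 0 := by
      linear_combination e
    rcases mul_eq_zero.mp ((mul_eq_zero.mp e').resolve_right hm) with e1 | e1
    · have : (m 0 : ℤ) - m 1 - k = 0 := by exact_mod_cast e1
      refine h (Finsupp.ext fun i => ?_)
      fin_cases i <;> simp <;> omega
    · have : (m 0 : ℤ) - m 1 + k + 1 = 0 := by exact_mod_cast e1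
      omega

theorem weightOp_lower_pow (k j : ℕ) :
    weightOp (lower^[j] (X 0 ^ k)) = ((k : ℂ) - j) • lower^[j] (X 0 ^ k) := by
  induction j with
  | zero =>
    ext m
    rw [Function.iterate_zero_apply, coeff_weightOp, coeff_smul, coeff_X_pow]
    split_ifs with h
    · simp [← h]
    · simp
  | succ j ih =>
    rw [Function.iterate_succ_apply', weightOp_lower, ih, Derivation.map_smul]
    push_cast
    module

theorem raise_lower_pow_succ (k j : ℕ) :
    raise (lower^[j + 1] (X 0 ^ k)) =
      (((j : ℂ) + 1) * (2 * k - j)) • lower^[j] (X 0 ^ k) := by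
  induction j with
  | zero =>
    have h : raise (X 0 ^ k) = 0 := by simp [raise_apply, pderiv_X]
    have := weightOp_lower_pow k 0
    simp only [Function.iterate_zero_apply] at this
    rw [zero_add, Function.iterate_one, raise_lower, h, two_mul (weightOp _), this, map_zero,
      Function.iterate_zero_apply]
    push_cast
    module
  | succ j ih =>
    rw [Function.iterate_succ_apply' lower (j + 1), raise_lower, ih, Derivation.map_smul,
      ← Function.iterate_succ_apply' lower, Nat.succ_eq_add_one, two_mul (weightOp _),
      weightOp_lower_pow]
    push_cast
    module

theorem iterate_raise_smul (j : ℕ) (c : ℂ) (f : MvPolynomial (Fin 3) ℂ) :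
    raise^[j] (c • f) = c • raise^[j] f :=
  Function.Commute.iterate_left (f := raise) (g := fun f => c • f)
    (fun f => Derivation.map_smul raise c f) j f

theorem raise_pow_lower_pow (k j : ℕ) (hj : j ≤ 2 * k) :
    ∃ c : ℂ, c ≠ 0 ∧ raise^[j] (lower^[j] (X 0 ^ k)) = c • X 0 ^ k := by
  induction j with
  | zero => exact ⟨1, one_ne_zero, by simp⟩
  | succ j ih =>
    obtain ⟨c, hc, h⟩ := ih (by omega)
    refine ⟨((j : ℂ) + 1) * (2 * k - j) * c, mul_ne_zero (mul_ne_zero ?_ ?_) hc, ?_⟩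
    · exact_mod_cast j.succ_ne_zero
    · rw [sub_ne_zero]
      exact_mod_cast (by omega : 2 * k ≠ j)
    · rw [Function.iterate_succ_apply, raise_lower_pow_succ]
      rw [iterate_raise_smul, h, smul_smul]

/-- Irreducibility of the space of complex spherical harmonics of degree `k`. -/
theorem le_of_raise_lower_stable {k : ℕ} {V W : Submodule ℂ (MvPolynomial (Fin 3) ℂ)} (hWV : W ≤ V)
    (hV : ∀ f ∈ V, raise f ∈ V) (hhom : ∀ f ∈ V, f.IsHomogeneous k)
    (hcas : ∀ f ∈ V, lower (raise f) + weightOp (weightOp f) + weightOp f =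
      ((k : ℂ) * (k + 1)) • f)
    (hWr : ∀ f ∈ W, raise f ∈ W) (hWl : ∀ f ∈ W, lower f ∈ W) (hW : W ≠ ⊥) : V ≤ W := by
  have hVpow (j : ℕ) : ∀ f ∈ V, raise^[j] f ∈ V := fun f hf =>
    Function.Iterate.rec (fun g => g ∈ V) hf (fun g hg => hV g hg) j
  have hWpow (j : ℕ) : ∀ f ∈ W, raise^[j] f ∈ W := fun f hf =>
    Function.Iterate.rec (fun g => g ∈ W) hf (fun g hg => hWr g hg) j
  have hWlpow (j : ℕ) : ∀ f ∈ W, lower^[j] f ∈ W := fun f hf =>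
    Function.Iterate.rec (fun g => g ∈ W) hf (fun g hg => hWl g hg) j
  have htop : ∀ f ∈ V, raise f = 0 → ∃ c : ℂ, f = c • X 0 ^ k := fun f hf h0 => by
    refine eq_smul_X_pow (hhom f hf) ?_
    rw [← hcas f hf, h0, map_zero, zero_add]
  have hnil : ∀ f ∈ V, raise^[2 * k + 1] f = 0 := fun f hf =>
    raise_pow_eq_zero (hhom _ (hVpow _ f hf))
  have hmem : X 0 ^ k ∈ W := by
    obtain ⟨f, hf, hf0⟩ := W.ne_bot_iff.mp hW
    have hex : ∃ n, raise^[n] f = 0 := ⟨_, hnil f (hWV hf)⟩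
    obtain ⟨n, hn⟩ : ∃ n, Nat.find hex = n + 1 :=
      Nat.exists_eq_succ_of_ne_zero fun h => hf0 (by simpa [h] using Nat.find_spec hex)
    have hne := Nat.find_min hex (m := n) (by omega)
    obtain ⟨c, hc⟩ := htop _ (hVpow n f (hWV hf)) (by
      rw [← Function.iterate_succ_apply' raise, ← Nat.succ_eq_add_one] at *
      rw [← hn]
      exact Nat.find_spec hex)
    have hc0 : c ≠ 0 := fun h => hne (by rw [hc, h, zero_smul])
    exact (W.smul_mem_iff hc0).mp (hc ▸ hWpow n f hf)
  have key (j : ℕ) (hj : j ≤ 2 * k + 1) : ∀ f ∈ V, raise^[j] f = 0 → f ∈ W := by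
    induction j with
    | zero =>
      intro f _ h
      rw [Function.iterate_zero_apply] at h
      exact h ▸ W.zero_mem
    | succ j ih =>
      intro f hf h
      obtain ⟨c, hc⟩ := htop _ (hVpow j f hf) (by rwa [← Function.iterate_succ_apply' raise])
      obtain ⟨d, hd, hd'⟩ := raise_pow_lower_pow k j (by omega)
      have hl := W.smul_mem (c / d) (hWlpow j _ hmem)
      refine (W.sub_mem_iff_left hl).mp (ih (by omega) _ (V.sub_mem hf (hWV hl)) ?_)
      rw [iterate_map_sub, iterate_raise_smul, hc, hd', smul_smul, div_mul_cancel₀ c hd, sub_self]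
  exact fun f hf => key _ le_rfl f hf (hnil f hf)

/-- Substitution of `x = (u + v) / 2`, `y = (u - v) / 2i` in a real polynomial. -/
def toWeightCoords : MvPolynomial (Fin 3) ℝ →ₐ[ℝ] MvPolynomial (Fin 3) ℂ :=
  aeval ![C (1 / 2) * (X 0 + X 1), C (-Complex.I / 2) * (X 0 - X 1), X 2]

/-- The real part of a complex polynomial in the coordinates `u, v, z`. -/
def realCoeffs : MvPolynomial (Fin 3) ℂ →ₗ[ℝ] MvPolynomial (Fin 3) ℝ :=
  (TensorProduct.lid ℝ _).toLinearMap ∘ₗ Complex.reLm.rTensor _ ∘ₗ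
    (algebraTensorAlgEquiv ℝ ℂ).symm.toLinearMap.restrictScalars ℝ ∘ₗ
    (aeval ![X 0 + C Complex.I * X 1, X 0 - C Complex.I * X 1, X 2] :
      MvPolynomial (Fin 3) ℂ →ₐ[ℂ] MvPolynomial (Fin 3) ℂ).toLinearMap.restrictScalars ℝ

theorem realCoeffs_smul_toWeightCoords (c : ℂ) (f : MvPolynomial (Fin 3) ℝ) :
    realCoeffs (c • toWeightCoords f) = c.re • f := by
  have h : ((aeval ![X 0 + C Complex.I * X 1, X 0 - C Complex.I * X 1, X 2] :
      MvPolynomial (Fin 3) ℂ →ₐ[ℂ] MvPolynomial (Fin 3) ℂ).restrictScalars ℝ).comp toWeightCoords =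
      mapAlgHom (Algebra.ofId ℝ ℂ) := by
    refine algHom_ext fun i => ?_
    have hI : (C Complex.I : MvPolynomial (Fin 3) ℂ) * C Complex.I = -1 := by
      rw [← C_mul, Complex.I_mul_I, C_neg, C_1]
    have h2 : (C (1 / 2 : ℂ) : MvPolynomial (Fin 3) ℂ) * 2 = 1 := by
      rw [← map_ofNat (C : ℂ →+* _), ← C_mul]; norm_num
    have h3 : (C (-Complex.I / 2) : MvPolynomial (Fin 3) ℂ) = -C Complex.I * C 2⁻¹ := by
      rw [← C_neg, ← C_mul]; ring_nf
    fin_cases i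
    · simp [toWeightCoords, ← algebraMap_eq]
      simp
      simp at h2
      linear_combination X 0 * h2
    · simp [toWeightCoords, ← algebraMap_eq]
      simp [h3]
      simp at h2
      linear_combination (- X 1 * C 2⁻¹ * 2) * hI + X 1 * h2
    · simp [toWeightCoords]
  have h' := congrArg (fun φ => φ f) h
  simp only [AlgHom.comp_apply, AlgHom.restrictScalars_apply] at h'
  have h4 : (mapAlgHom (Algebra.ofId ℝ ℂ)) f = MvPolynomial.map (algebraMap ℝ ℂ) f := rfl
  rw [h4] at h'
  simp only [realCoeffs, LinearMap.comp_apply, LinearMap.restrictScalars_apply,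
    AlgHom.toLinearMap_apply, AlgEquiv.toLinearMap_apply, map_smul, LinearEquiv.coe_coe]
  rw [h', algebraTensorAlgEquiv_symm_map, TensorProduct.smul_tmul']
  simp

/-- A complex derivation that agrees on coordinates with a combination of infinitesimal rotations
agrees with it everywhere. -/
theorem derivation_toWeightCoords
    (D : Derivation ℂ (MvPolynomial (Fin 3) ℂ) (MvPolynomial (Fin 3) ℂ)) (a : Fin 3 → ℂ)
    (h : ∀ i, D (toWeightCoords (X i)) = ∑ j, a j • toWeightCoords (rot j (X i)))
    (f : MvPolynomial (Fin 3) ℝ) :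
    D (toWeightCoords f) = ∑ j, a j • toWeightCoords (rot j f) := by
  induction f using MvPolynomial.induction_on with
  | C c =>
    have hc : toWeightCoords (C c) = C (c : ℂ) := by
      simp [toWeightCoords, algebraMap_eq, IsScalarTower.algebraMap_apply ℝ ℂ (MvPolynomial _ ℂ)]
    simp [hc, derivation_C]
  | add p q hp hq => simp only [map_add, hp, hq, smul_add, Finset.sum_add_distrib]
  | mul_X p i hp =>
    simp only [map_mul, Derivation.leibniz, hp, h, map_add, smul_eq_mul, smul_add,
      Finset.sum_add_distrib, Finset.mul_sum, mul_smul_comm]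

theorem toWeightCoords_X_zero :
    toWeightCoords (X 0) = (1 / 2 : ℂ) • (X 0 + X 1) := by
  rw [MvPolynomial.smul_eq_C_mul]
  exact aeval_X _ _

theorem toWeightCoords_X_one :
    toWeightCoords (X 1) = (-Complex.I / 2) • (X 0 - X 1) := by
  rw [MvPolynomial.smul_eq_C_mul]
  exact aeval_X _ _

theorem toWeightCoords_X_two : toWeightCoords (X 2) = X 2 :=
  aeval_X _ _

theorem raise_toWeightCoords (f : MvPolynomial (Fin 3) ℝ) :
    raise (toWeightCoords f) =
      Complex.I • toWeightCoords (rot 0 f) - toWeightCoords (rot 1 f) := by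
  rw [derivation_toWeightCoords raise ![Complex.I, -1, 0], Fin.sum_univ_three]
  · simp [sub_eq_add_neg]
  · intro i
    have hI : Complex.I * (-Complex.I / 2) = 1 / 2 := by
      linear_combination (-1 / 2 : ℂ) * Complex.I_mul_I
    fin_cases i <;>
      simp [Fin.sum_univ_three, toWeightCoords_X_zero, toWeightCoords_X_one, toWeightCoords_X_two,
        rot_zero_apply, rot_one_apply, rot_two_apply, raise_apply, pderiv_X, two_mul, smul_smul, hI] <;>
      module

theorem lower_toWeightCoords (f : MvPolynomial (Fin 3) ℝ) :
    lower (toWeightCoords f) =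
      Complex.I • toWeightCoords (rot 0 f) + toWeightCoords (rot 1 f) := by
  rw [derivation_toWeightCoords lower ![Complex.I, 1, 0], Fin.sum_univ_three]
  · simp
  · intro i
    have hI : Complex.I * (-Complex.I / 2) = 1 / 2 := by
      linear_combination (-1 / 2 : ℂ) * Complex.I_mul_I
    fin_cases i <;>
      simp [Fin.sum_univ_three, toWeightCoords_X_zero, toWeightCoords_X_one, toWeightCoords_X_two,
        rot_zero_apply, rot_one_apply, rot_two_apply, lower_apply, pderiv_X, two_mul, smul_smul, hI] <;>
      module

theorem weightOp_toWeightCoords (f : MvPolynomial (Fin 3) ℝ) :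
    weightOp (toWeightCoords f) = Complex.I • toWeightCoords (rot 2 f) := by
  rw [derivation_toWeightCoords weightOp ![0, 0, Complex.I], Fin.sum_univ_three]
  · simp
  · intro i
    have hI : Complex.I * (-Complex.I / 2) = 1 / 2 := by
      linear_combination (-1 / 2 : ℂ) * Complex.I_mul_I
    fin_cases i <;>
      simp [Fin.sum_univ_three, toWeightCoords_X_zero, toWeightCoords_X_one, toWeightCoords_X_two,
        rot_zero_apply, rot_one_apply, rot_two_apply, weightOp_apply, pderiv_X, smul_smul, hI] <;>
      module

theorem casimir_toWeightCoords (f : MvPolynomial (Fin 3) ℝ) :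
    lower (raise (toWeightCoords f)) + weightOp (weightOp (toWeightCoords f)) +
      weightOp (toWeightCoords f) = toWeightCoords (casimir f) := by
  rw [casimir_apply, raise_toWeightCoords, weightOp_toWeightCoords, map_sub, Derivation.map_smul,
    Derivation.map_smul, weightOp_toWeightCoords, lower_toWeightCoords, lower_toWeightCoords,
    ← rot_zero_rot_one_sub f]
  simp only [map_neg, map_add, map_sub, smul_add, smul_sub, smul_smul, Complex.I_mul_I]
  module

theorem toWeightCoords_isHomogeneous {k : ℕ} {f : MvPolynomial (Fin 3) ℝ} (hf : f.IsHomogeneous k) :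
    (toWeightCoords f).IsHomogeneous k := by
  have h := hf.aeval (S := ℂ) (τ := Fin 3) (n := 1)
    ![C (1 / 2) * (X 0 + X 1), C (-Complex.I / 2) * (X 0 - X 1), X 2] fun i => by
      fin_cases i
      · exact ((isHomogeneous_X _ _).add (isHomogeneous_X _ _)).C_mul _
      · exact ((isHomogeneous_X _ _).sub (isHomogeneous_X _ _)).C_mul _
      · exact isHomogeneous_X _ _
  rw [one_mul] at h
  exact h

/-- The complex span of a space of real polynomials, in the coordinates `u, v, z`. -/
def complexSpan (U : Submodule ℝ (MvPolynomial (Fin 3) ℝ)) :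
    Submodule ℂ (MvPolynomial (Fin 3) ℂ) :=
  Submodule.span ℂ (toWeightCoords '' U)

theorem toWeightCoords_mem_complexSpan {U : Submodule ℝ (MvPolynomial (Fin 3) ℝ)}
    {f : MvPolynomial (Fin 3) ℝ} (hf : f ∈ U) : toWeightCoords f ∈ complexSpan U :=
  Submodule.subset_span ⟨f, hf, rfl⟩

theorem mem_of_toWeightCoords_mem_complexSpan {U : Submodule ℝ (MvPolynomial (Fin 3) ℝ)}
    {f : MvPolynomial (Fin 3) ℝ} (hf : toWeightCoords f ∈ complexSpan U) : f ∈ U := by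
  have key : ∀ p ∈ complexSpan U, ∀ c : ℂ, realCoeffs (c • p) ∈ U := fun p hp => by
    induction hp using Submodule.span_induction with
    | mem p hp =>
      obtain ⟨g, hg, rfl⟩ := hp
      intro c
      rw [realCoeffs_smul_toWeightCoords]
      exact U.smul_mem _ hg
    | zero => simp
    | add p q _ _ hp hq =>
      intro c
      rw [smul_add, map_add]
      exact U.add_mem (hp c) (hq c)
    | smul a p _ hp =>
      intro c
      rw [smul_smul]
      exact hp _
  have := key _ hf 1
  rwa [realCoeffs_smul_toWeightCoords, Complex.one_re, one_smul] at this

theorem derivation_mem_complexSpan {U : Submodule ℝ (MvPolynomial (Fin 3) ℝ)}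
    (D : Derivation ℂ (MvPolynomial (Fin 3) ℂ) (MvPolynomial (Fin 3) ℂ))
    (hD : ∀ f ∈ U, D (toWeightCoords f) ∈ complexSpan U) :
    ∀ p ∈ complexSpan U, D p ∈ complexSpan U := fun p hp => by
  induction hp using Submodule.span_induction with
  | mem p hp =>
    obtain ⟨g, hg, rfl⟩ := hp
    exact hD g hg
  | zero => simp
  | add p q _ _ hp hq =>
    rw [map_add]
    exact add_mem hp hq
  | smul a p _ hp =>
    rw [Derivation.map_smul]
    exact Submodule.smul_mem _ _ hp

theorem raise_mem_complexSpan {U : Submodule ℝ (MvPolynomial (Fin 3) ℝ)}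
    (hU : ∀ i, ∀ f ∈ U, rot i f ∈ U) : ∀ p ∈ complexSpan U, raise p ∈ complexSpan U :=
  derivation_mem_complexSpan raise fun f hf => raise_toWeightCoords f ▸ sub_mem
    (Submodule.smul_mem _ _ (toWeightCoords_mem_complexSpan (hU 0 f hf)))
    (toWeightCoords_mem_complexSpan (hU 1 f hf))

theorem lower_mem_complexSpan {U : Submodule ℝ (MvPolynomial (Fin 3) ℝ)}
    (hU : ∀ i, ∀ f ∈ U, rot i f ∈ U) : ∀ p ∈ complexSpan U, lower p ∈ complexSpan U :=
  derivation_mem_complexSpan lower fun f hf => lower_toWeightCoords f ▸ add_mem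
    (Submodule.smul_mem _ _ (toWeightCoords_mem_complexSpan (hU 0 f hf)))
    (toWeightCoords_mem_complexSpan (hU 1 f hf))

/-- Irreducibility of the space of real spherical harmonics of degree `k`. -/
theorem harmonicHomog_le_of_rot_stable {k : ℕ} {U : Submodule ℝ (MvPolynomial (Fin 3) ℝ)}
    (hUk : U ≤ harmonicHomog k) (hU : ∀ i, ∀ f ∈ U, rot i f ∈ U) (hU0 : U ≠ ⊥) :
    harmonicHomog k ≤ U := by
  have hle : complexSpan (harmonicHomog k) ≤ complexSpan U := by
    refine le_of_raise_lower_stable (k := k) (Submodule.span_mono (Set.image_mono hUk))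
      (raise_mem_complexSpan fun i f => rot_mem_harmonicHomog i) (fun p hp => ?_) (fun p hp => ?_)
      (raise_mem_complexSpan hU) (lower_mem_complexSpan hU) fun h => ?_
    · refine (Submodule.span_le (p := homogeneousSubmodule (Fin 3) ℂ k)).mpr ?_ hp
      rintro _ ⟨f, hf, rfl⟩
      exact toWeightCoords_isHomogeneous hf.1
    · induction hp using Submodule.span_induction with
      | mem p hp =>
        obtain ⟨f, hf, rfl⟩ := hp
        rw [casimir_toWeightCoords, casimir_of_mem_harmonicHomog hf, map_smul,
          ← algebraMap_smul ℂ]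
        simp
      | zero => simp
      | add p q _ _ hp hq =>
        simp only [map_add, smul_add, ← hp, ← hq]
        abel
      | smul a p _ hp => simp only [Derivation.map_smul, ← smul_add, hp, smul_comm a]
    · refine hU0 ((Submodule.eq_bot_iff _).mpr fun f hf => ?_)
      refine (Submodule.mem_bot ℝ).mp (mem_of_toWeightCoords_mem_complexSpan ?_)
      have := toWeightCoords_mem_complexSpan hf
      rw [h, Submodule.mem_bot] at this
      rw [this]
      exact zero_mem _
  exact fun f hf =>
    mem_of_toWeightCoords_mem_complexSpan (hle (toWeightCoords_mem_complexSpan hf))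

/-! ### Separating harmonic components -/

theorem exists_polynomial_casimir_eq_zero {k : ℕ} {r : MvPolynomial (Fin 3) ℝ}
    (hr : r ∈ ⨆ (l : ℕ) (_ : l ≠ k), harmonicHomog l) :
    ∃ A : Polynomial ℝ, Polynomial.aeval casimir A r = 0 ∧ A.eval ((k : ℝ) * (k + 1)) ≠ 0 := by
  rw [iSup_subtype'] at hr
  induction hr using Submodule.iSup_induction' with
  | mem l f hf =>
    refine ⟨Polynomial.X - Polynomial.C ((l : ℝ) * (l + 1)), ?_, ?_⟩
    · rw [map_sub, Polynomial.aeval_X, Polynomial.aeval_C, LinearMap.sub_apply,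
        casimir_of_mem_harmonicHomog hf, Module.algebraMap_end_apply, sub_self]
    · have hl : (l : ℕ) ≠ k := l.2
      have h : ((k : ℝ) - (l : ℕ)) * ((k : ℝ) + (l : ℕ) + 1) ≠ 0 :=
        mul_ne_zero (sub_ne_zero.mpr (by exact_mod_cast hl.symm)) (by positivity)
      simp only [Polynomial.eval_sub, Polynomial.eval_X, Polynomial.eval_C]
      convert h using 1
      ring
  | zero => exact ⟨1, by simp⟩
  | add p q _ _ hp hq =>
    obtain ⟨A, hA, hA'⟩ := hp
    obtain ⟨B, hB, hB'⟩ := hq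
    refine ⟨A * B, ?_, by simpa using ⟨hA', hB'⟩⟩
    rw [map_add]
    nth_rw 1 [mul_comm A B]
    rw [map_mul, map_mul, Module.End.mul_apply, Module.End.mul_apply, hA, hB, map_zero, map_zero,
      add_zero]

theorem component_mem_of_rot_stable {U : Submodule ℝ (MvPolynomial (Fin 3) ℝ)}
    (hU : ∀ i, ∀ f ∈ U, rot i f ∈ U) {k : ℕ} {q r : MvPolynomial (Fin 3) ℝ}
    (hq : q ∈ harmonicHomog k) (hr : r ∈ ⨆ (l : ℕ) (_ : l ≠ k), harmonicHomog l)
    (h : q + r ∈ U) : q ∈ U := by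
  obtain ⟨A, hA, hA'⟩ := exists_polynomial_casimir_eq_zero hr
  have hcas : U ≤ U.comap casimir := fun f hf => U.neg_mem
    (U.add_mem (U.add_mem (hU 0 _ (hU 0 f hf)) (hU 1 _ (hU 1 f hf))) (hU 2 _ (hU 2 f hf)))
  have hmem : Polynomial.aeval casimir A (q + r) ∈ U :=
    A.aeval_apply_smul_mem_of_le_comap h casimir hcas
  rw [map_add, hA, add_zero,
    Module.End.aeval_apply_of_mem_apply_eq_smul (casimir_of_mem_harmonicHomog hq)] at hmem
  exact (U.smul_mem_iff hA').mp hmem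

/-! ### The bracket on the sphere -/

theorem toSphere_rep (s : ℝ) (p : SpherePoly s) : toSphere s (rep s p) = p :=
  (Ideal.Quotient.mk_surjective (I := sphereIdeal s) p).choose_spec

/-- The bracket on the sphere can be computed on any representatives. -/
theorem pbS_toSphere (s : ℝ) (f g : MvPolynomial (Fin 3) ℝ) :
    pbS s (toSphere s f) (toSphere s g) = toSphere s (pb f g) := by
  have hrep (f : MvPolynomial (Fin 3) ℝ) : ∃ c, rep s (toSphere s f) =
      f + (X 0 ^ 2 + X 1 ^ 2 + X 2 ^ 2 - C (s ^ 2)) * c := by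
    obtain ⟨c, hc⟩ := Ideal.mem_span_singleton.mp
      (Ideal.Quotient.eq.mp (toSphere_rep s (toSphere s f)))
    exact ⟨c, sub_eq_iff_eq_add'.mp hc⟩
  obtain ⟨c, hc⟩ := hrep f
  obtain ⟨d, hd⟩ := hrep g
  refine Ideal.Quotient.eq.mpr (Ideal.mem_span_singleton.mpr ?_)
  rw [hc, hd]
  refine ⟨pb f d + pb c g + (X 0 ^ 2 + X 1 ^ 2 + X 2 ^ 2 - C (s ^ 2)) * pb c d, ?_⟩
  simp only [pb, map_add, map_sub, Derivation.leibniz, pderiv_pow, pderiv_X, pderiv_C, smul_eq_mul]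
  simp
  ring

/-- Lemma 2.4: if a Poisson subalgebra `R` of `P` contains `H₁` and some element of `R`
has a nonzero degree-`k` harmonic component, then `H_k ⊆ R`. -/
theorem Hk_le_of_nonzero_component (s : ℝ) (hs : 0 < s)
    (R : Submodule ℝ (SpherePoly s))
    (hpoisson : ∀ p ∈ R, ∀ q ∈ R, pbS s p q ∈ R)
    (hH1 : Hsph s 1 ≤ R)
    (p : SpherePoly s) (hp : p ∈ R) (k : ℕ) (hk : hcomp s k p ≠ 0) :
    Hsph s k ≤ R := by
  set U := R.comap (Ideal.Quotient.mkₐ ℝ (sphereIdeal s)).toLinearMap with hUdef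
  have hU : ∀ i, ∀ f ∈ U, rot i f ∈ U := fun i f hf => by
    have := hpoisson _ (hH1 (S_mem_H1 s i)) _ hf
    change pbS s (toSphere s (X i)) (toSphere s f) ∈ R at this
    rwa [pbS_toSphere, pb_X_left] at this
  have hex : ∃ q, q ∈ Hsph s k ∧ p - q ∈ ⨆ (l : ℕ) (_ : l ≠ k), Hsph s l := by
    by_contra h
    exact hk (dif_neg h)
  obtain ⟨q, hq, hpq, hq0⟩ :
      ∃ q, q ∈ Hsph s k ∧ p - q ∈ (⨆ (l : ℕ) (_ : l ≠ k), Hsph s l) ∧ q ≠ 0 :=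
    ⟨hex.choose, hex.choose_spec.1, hex.choose_spec.2, by rwa [hcomp, dif_pos hex] at hk⟩
  simp only [Hsph, ← Submodule.map_iSup] at hpq
  obtain ⟨f, hf, rfl⟩ := hq
  obtain ⟨r, hr, hfr⟩ := hpq
  have hfU : f ∈ U := component_mem_of_rot_stable hU hf hr (by
    rw [hUdef, Submodule.mem_comap, map_add, hfr, add_sub_cancel]
    exact hp)
  have hle := harmonicHomog_le_of_rot_stable (k := k) (U := U ⊓ harmonicHomog k) inf_le_right
    (fun i g hg => ⟨hU i g hg.1, rot_mem_harmonicHomog i hg.2⟩)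
    ((Submodule.ne_bot_iff _).mpr ⟨f, ⟨hfU, hf⟩, fun h => hq0 (by rw [h, map_zero])⟩)
  exact Submodule.map_le_iff_le_comap.mpr (hle.trans inf_le_left)

end
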